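/- Let n ≥ 1 and l = 2n−1. Let C be the (symmetric) Cartan matrix of type A_l and let C̃ be the affine Cartan matrix of type A_l^{(1)} (size 2n, indexed by 0,1,…,2n−1 arranged in a cycle: diagonal entries 2, entries −1 between cyclically adjacent indices, 0 otherwise; for n = 1 the two off-diagonal entries are −2). Define simple reflections by s_i(e_j) = e_j − c_{ij} e_i in the respective standard bases, let c = s₁s₂⋯s_l be the Coxeter element, and let c_a = (s₀s₂⋯s_{2n−2})·(s₁s₃⋯s_{2n−1}) be the affine Coxeter element taken in the bipartite ordering. Then det(t·I − c) = (t^{2n} − 1)/(t − 1), det(t·I − c_a) = (t^n − 1)², and consequently the Poincaré series p(t) = (1−t^{2n})/((1−t)(1−t^n)²) of the Kleinian singularity of type A_{2n−1} satisfies p(t) = det(t·I − c)/det(t·I − c_a) as rational functions. -/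

import Mathlib

open Polynomial

/-- The simple reflection `s_i` associated to a (generalized) Cartan matrix `C`,
acting on the standard basis by `s_i(e_j) = e_j - c_{ij} e_i`. -/
def simpleRefl {N : ℕ} (C : Matrix (Fin N) (Fin N) ℚ) (i : Fin N) :
    Matrix (Fin N) (Fin N) ℚ :=
  Matrix.of fun k j => (if k = j then 1 else 0) - (if k = i then C i j else 0)

/-- The Cartan matrix of type `A_l` (indices `0, …, l-1` in a chain). -/
def cartanA (l : ℕ) : Matrix (Fin l) (Fin l) ℚ :=
  Matrix.of fun i j =>
    if i = j then 2 else if i.val + 1 = j.val ∨ j.val + 1 = i.val then -1 else 0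

/-- The affine Cartan matrix of type `A_{N-1}^{(1)}` (indices `0, …, N-1` arranged in a
cycle; for `N = 2` the two off-diagonal entries are `-2`). -/
def cartanAAffine (N : ℕ) : Matrix (Fin N) (Fin N) ℚ :=
  Matrix.of fun i j =>
    if i = j then 2
    else -(((if (i.val + 1) % N = j.val then 1 else 0)
            + (if (j.val + 1) % N = i.val then 1 else 0) : ℚ))

/-- The characteristic polynomial of a companion matrix. -/
theorem charpoly_eq_of_companion {m : ℕ} (M : Matrix (Fin (m + 1)) (Fin (m + 1)) ℚ)
    (a : Fin (m + 1) → ℚ)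
    (hM : ∀ i (j : Fin m), M i j.castSucc = if i = j.succ then 1 else 0)
    (hlast : ∀ i, M i (Fin.last m) = -a i) :
    M.charpoly = X ^ (m + 1) + ∑ i : Fin (m + 1), C (a i) * X ^ (i : ℕ) := by
  have hpow : ∀ k (hk : k < m + 1),
      (M ^ k).mulVec (Pi.single 0 1) = Pi.single (⟨k, hk⟩ : Fin (m + 1)) 1 := by
    intro k
    induction k with
    | zero => intro hk; rw [pow_zero, Matrix.one_mulVec]; rfl
    | succ k ih =>
      intro hk
      rw [pow_succ', ← Matrix.mulVec_mulVec, ih (by omega), Matrix.mulVec_single_one]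
      ext i
      have := hM i ⟨k, by omega⟩
      simp only [Matrix.col_apply, Pi.single_apply]
      exact this
  have htop : (M ^ (m + 1)).mulVec (Pi.single 0 1) = -a := by
    rw [pow_succ', ← Matrix.mulVec_mulVec, hpow m (by omega), Matrix.mulVec_single_one]
    ext i
    exact hlast i
  set q : ℚ[X] := ∑ i : Fin (m + 1), C (a i) * X ^ (i : ℕ) with hq
  have hqdeg : q.degree < ((m + 1 : ℕ) : WithBot ℕ) := degree_sum_fin_lt a
  have hmonic : (X ^ (m + 1) + q).Monic := monic_X_pow_add hqdeg
  have hdeg : (X ^ (m + 1) + q).degree = ((m + 1 : ℕ) : WithBot ℕ) := by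
    rw [degree_add_eq_left_of_degree_lt] <;> simp only [degree_X_pow]
    exact hqdeg
  have hroot : (aeval M (X ^ (m + 1) + q)).mulVec (Pi.single 0 1) = 0 := by
    simp only [hq, map_add, map_pow, aeval_X, map_sum, map_mul, aeval_C, Matrix.add_mulVec,
      htop, Matrix.sum_mulVec, Algebra.algebraMap_eq_smul_one, smul_mul_assoc, one_mul,
      Matrix.smul_mulVec, hpow _ (Fin.is_lt _)]
    ext i
    simp [Finset.sum_apply, Pi.single_apply]
  have hcdeg : M.charpoly.degree = ((m + 1 : ℕ) : WithBot ℕ) := by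
    rw [Matrix.charpoly_degree_eq_dim, Fintype.card_fin]
  have hlt : (M.charpoly - (X ^ (m + 1) + q)).degree < ((m + 1 : ℕ) : WithBot ℕ) := by
    rw [← hcdeg]
    apply degree_sub_lt_left (hcdeg.trans hdeg.symm) M.charpoly_monic.ne_zero
    rw [M.charpoly_monic.leadingCoeff, hmonic.leadingCoeff]
  have hzero : (aeval M (M.charpoly - (X ^ (m + 1) + q))).mulVec (Pi.single 0 1) = 0 := by
    rw [map_sub, Matrix.sub_mulVec, hroot, Matrix.aeval_self_charpoly, Matrix.zero_mulVec, sub_zero]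
  rw [← sub_eq_zero]
  set p := M.charpoly - (X ^ (m + 1) + q)
  by_cases hp : p = 0
  · exact hp
  have hnat : p.natDegree < m + 1 := (natDegree_lt_iff_degree_lt hp).2 hlt
  rw [aeval_eq_sum_range' hnat, Finset.sum_range, Matrix.sum_mulVec] at hzero
  simp only [Matrix.smul_mulVec, hpow _ (Fin.is_lt _)] at hzero
  ext k
  by_cases hk : k < m + 1
  · have := congrFun hzero ⟨k, hk⟩
    simpa [Finset.sum_apply, Pi.single_apply] using this
  · rw [coeff_zero]
    exact coeff_eq_zero_of_natDegree_lt (by omega)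

theorem mul_simpleRefl_apply {N : ℕ} (C P : Matrix (Fin N) (Fin N) ℚ) (k i j : Fin N) :
    (P * simpleRefl C k) i j = P i j - P i k * C k j := by
  simp [simpleRefl, Matrix.mul_apply, mul_sub, Finset.sum_sub_distrib]

theorem simpleRefl_mul_apply {N : ℕ} (C P : Matrix (Fin N) (Fin N) ℚ) (k i j : Fin N) :
    (simpleRefl C k * P) i j = P i j - if i = k then ∑ m, C k m * P m j else 0 := by
  by_cases h : i = k <;>
    simp [simpleRefl, Matrix.mul_apply, sub_mul, Finset.sum_sub_distrib, h]

/-- The product of the first `k` simple reflections of type `A_l`. -/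
theorem prod_take_simpleRefl_cartanA (l k : ℕ) (hk : k ≤ l) (i j : Fin l) :
    (((List.finRange l).take k).map (simpleRefl (cartanA l))).prod i j =
      if j.val + 1 < k then (if i.val = j.val + 1 then 1 else 0)
      else if j.val + 1 = k then (if i.val < k then -1 else 0)
      else if j.val = k then (if i.val ≤ k then 1 else 0)
      else (if i.val = j.val then 1 else 0) := by
  induction k generalizing i j with
  | zero =>
    simp only [List.take_zero, List.map_nil, List.prod_nil, Matrix.one_apply, Fin.ext_iff]
    grind
  | succ k ih =>
    have hlen : k < (List.finRange l).length := by simpa using hk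
    rw [List.take_succ_eq_append_getElem hlen, List.map_append, List.prod_append]
    simp only [List.map_cons, List.map_nil, List.prod_cons, List.prod_nil, mul_one,
      List.getElem_finRange, mul_simpleRefl_apply]
    rw [ih (by omega), ih (by omega)]
    simp only [cartanA, Matrix.of_apply, Fin.ext_iff, Fin.val_cast]
    grind

theorem charpoly_coxeter_cartanA (l : ℕ) :
    (List.ofFn fun i : Fin l => simpleRefl (cartanA l) i).prod.charpoly * (X - 1)
      = X ^ (l + 1) - 1 := by
  have hform := prod_take_simpleRefl_cartanA l l le_rfl
  rw [List.take_of_length_le (by simp), ← List.ofFn_eq_map] at hform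
  rcases l with _ | m
  · simp
  rw [charpoly_eq_of_companion _ (fun _ => 1)]
  · rw [← geom_sum_mul, Finset.sum_range_succ, Finset.sum_range, add_comm]
    simp
  · intro i j
    rw [hform]
    simp [Fin.ext_iff]
  · intro i
    rw [hform]
    simp [i.is_lt]

theorem prod_map_simpleRefl_of_orthogonal {N : ℕ} (C : Matrix (Fin N) (Fin N) ℚ)
    (L : List (Fin N)) (hL : L.Nodup) (hC : ∀ i ∈ L, ∀ j ∈ L, i ≠ j → C i j = 0)
    (i j : Fin N) :
    (L.map (simpleRefl C)).prod i j =
      (if i = j then 1 else 0) - if i ∈ L then C i j else 0 := by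
  induction L generalizing i j with
  | nil => simp [Matrix.one_apply]
  | cons a L ih =>
    rw [List.nodup_cons] at hL
    have ih' := ih hL.2 fun i hi j hj =>
      hC i (List.mem_cons_of_mem _ hi) j (List.mem_cons_of_mem _ hj)
    rw [List.map_cons, List.prod_cons, simpleRefl_mul_apply, ih']
    by_cases hia : i = a
    · subst hia
      have hsum : ∑ m, C i m * (L.map (simpleRefl C)).prod m j = C i j := by
        rw [Finset.sum_eq_single j]
        · rw [ih']
          by_cases hj : j ∈ L
          · simp [hC i (by simp) j (by simp [hj]) (by rintro rfl; exact hL.1 hj)]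
          · simp [hj]
        · intro m _ hmj
          rw [ih', if_neg hmj]
          by_cases hm : m ∈ L
          · simp [hC i (by simp) m (by simp [hm]) (by rintro rfl; exact hL.1 hm)]
          · simp [hm]
        · simp
      rw [hsum]
      simp [hL.1]
    · simp [hia]

/-- The cyclic successor on `Fin n`. -/
def cyclicSucc {n : ℕ} (j : Fin n) : Fin n :=
  ⟨(j.val + 1) % n, Nat.mod_lt _ j.pos⟩

theorem cyclicSucc_injective {n : ℕ} : Function.Injective (cyclicSucc (n := n)) := by
  intro i j h
  have h' : (i.val + 1) % n = (j.val + 1) % n := congrArg Fin.val h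
  have h2 : i.val ≡ j.val [MOD n] := Nat.ModEq.add_right_cancel' 1 h'
  exact Fin.ext (h2.eq_of_lt_of_lt i.is_lt j.is_lt)

/-- The matrix of the cyclic shift `e_j ↦ e_{j+1}`. -/
def cyclicShift (n : ℕ) : Matrix (Fin n) (Fin n) ℚ :=
  Matrix.of fun i j => if i = cyclicSucc j then 1 else 0

theorem cyclicShift_transpose_mul_self (n : ℕ) : (cyclicShift n).transpose * cyclicShift n = 1 := by
  ext i j
  simp [cyclicShift, Matrix.mul_apply, Matrix.one_apply, cyclicSucc_injective.eq_iff, eq_comm]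

theorem cyclicShift_mul_transpose_self (n : ℕ) : cyclicShift n * (cyclicShift n).transpose = 1 :=
  mul_eq_one_comm.1 (cyclicShift_transpose_mul_self n)

theorem charpoly_cyclicShift {n : ℕ} (hn : 1 ≤ n) : (cyclicShift n).charpoly = X ^ n - 1 := by
  obtain ⟨m, rfl⟩ : ∃ m, n = m + 1 := ⟨n - 1, by omega⟩
  rw [charpoly_eq_of_companion _ (fun i => if i = 0 then -1 else 0)]
  · rw [Finset.sum_eq_single 0]
    · simp [sub_eq_add_neg]
    · intro i _ hi
      simp [hi]
    · simp
  · intro i j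
    have : (j.val + 1) % (m + 1) = j.val + 1 := Nat.mod_eq_of_lt (by omega)
    simp [cyclicShift, cyclicSucc, Fin.ext_iff, this]
  · intro i
    by_cases hi : i = 0 <;> simp [cyclicShift, cyclicSucc, Fin.ext_iff, hi]

/-- The indices `0, …, 2n-1` split into even and odd ones. -/
def evenOddEquiv (n : ℕ) : Fin n ⊕ Fin n ≃ Fin (2 * n) where
  toFun := Sum.elim (fun j => ⟨2 * j.val, by omega⟩) (fun j => ⟨2 * j.val + 1, by omega⟩)
  invFun i := if i.val % 2 = 0 then Sum.inl ⟨i.val / 2, by omega⟩ else Sum.inr ⟨i.val / 2, by omega⟩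
  left_inv := by
    rintro (j | j)
    · simp
    · simp [Fin.ext_iff, Nat.add_mod]
      omega
  right_inv := by
    intro i
    by_cases h : i.val % 2 = 0 <;> simp [h, Fin.ext_iff] <;> omega

theorem two_mul_add_two_mod (n a : ℕ) : (2 * a + 1 + 1) % (2 * n) = 2 * ((a + 1) % n) := by
  rw [← Nat.mul_mod_mul_left]
  ring_nf

theorem cartanAAffine_eq_zero_of_parity {n : ℕ} {i j : Fin (2 * n)} (hij : i ≠ j)
    (h : i.val % 2 = j.val % 2) : cartanAAffine (2 * n) i j = 0 := by
  have key : ∀ a b : ℕ, a % 2 = b % 2 → (a + 1) % (2 * n) ≠ b := by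
    intro a b hab hmod
    have := Nat.mod_mod_of_dvd (a + 1) (Dvd.intro n rfl : 2 ∣ 2 * n)
    rw [hmod] at this
    omega
  simp [cartanAAffine, hij, key _ _ h, key _ _ h.symm]

theorem prod_parity_simpleRefl_apply (n r : ℕ) (i j : Fin (2 * n)) :
    (((List.finRange (2 * n)).filter fun i => i.val % 2 = r).map
      (simpleRefl (cartanAAffine (2 * n)))).prod i j =
      (if i = j then 1 else 0) - if i.val % 2 = r then cartanAAffine (2 * n) i j else 0 := by
  rw [prod_map_simpleRefl_of_orthogonal]
  · simp
  · exact (List.nodup_finRange _).filter _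
  · intro i hi j hj hij
    simp only [List.mem_filter, List.mem_finRange, true_and, decide_eq_true_eq] at hi hj
    exact cartanAAffine_eq_zero_of_parity hij (hi.trans hj.symm)

theorem prod_even_simpleRefl_submatrix (n : ℕ) :
    (((List.finRange (2 * n)).filter fun i => i.val % 2 = 0).map
      (simpleRefl (cartanAAffine (2 * n)))).prod.submatrix (evenOddEquiv n) (evenOddEquiv n) =
      Matrix.fromBlocks (-1) (1 + cyclicShift n) 0 1 := by
  ext (i | i) (j | j) <;>
    rw [Matrix.submatrix_apply, prod_parity_simpleRefl_apply]
  · by_cases hij : i = j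
    · subst hij
      simp [evenOddEquiv, cartanAAffine]
      norm_num
    · have h : evenOddEquiv n (Sum.inl i) ≠ evenOddEquiv n (Sum.inl j) := by simpa using hij
      rw [cartanAAffine_eq_zero_of_parity h (by simp [evenOddEquiv])]
      simp [hij]
  · have h1 : (2 * i.val + 1) % (2 * n) = 2 * i.val + 1 := Nat.mod_eq_of_lt (by omega)
    have h2 : 2 * i.val ≠ 2 * j.val + 1 := by omega
    simp [evenOddEquiv, cartanAAffine, Fin.ext_iff, h1, h2, two_mul_add_two_mod, cyclicShift,
      cyclicSucc, Matrix.one_apply, eq_comm]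
  · have h2 : 2 * i.val + 1 ≠ 2 * j.val := by omega
    simp [evenOddEquiv, Fin.ext_iff, h2, Nat.add_mod]
  · simp [evenOddEquiv, Fin.ext_iff, Nat.add_mod, Matrix.one_apply]

theorem prod_odd_simpleRefl_submatrix (n : ℕ) :
    (((List.finRange (2 * n)).filter fun i => i.val % 2 = 1).map
      (simpleRefl (cartanAAffine (2 * n)))).prod.submatrix (evenOddEquiv n) (evenOddEquiv n) =
      Matrix.fromBlocks 1 0 (1 + (cyclicShift n).transpose) (-1) := by
  ext (i | i) (j | j) <;>
    rw [Matrix.submatrix_apply, prod_parity_simpleRefl_apply]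
  · simp [evenOddEquiv, Fin.ext_iff, Matrix.one_apply]
  · have h2 : 2 * i.val ≠ 2 * j.val + 1 := by omega
    simp [evenOddEquiv, Fin.ext_iff, h2]
  · have h1 : (2 * j.val + 1) % (2 * n) = 2 * j.val + 1 := Nat.mod_eq_of_lt (by omega)
    have h2 : 2 * i.val + 1 ≠ 2 * j.val := by omega
    have h3 : (2 * i.val + 1) % 2 = 1 := by omega
    simp [evenOddEquiv, cartanAAffine, Fin.ext_iff, h1, h2, h3, two_mul_add_two_mod, cyclicShift,
      cyclicSucc, Matrix.one_apply]
    rw [add_comm]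
    simp only [eq_comm]
  · by_cases hij : i = j
    · subst hij
      simp [evenOddEquiv, cartanAAffine, Nat.add_mod]
      norm_num
    · have h : evenOddEquiv n (Sum.inr i) ≠ evenOddEquiv n (Sum.inr j) := by simpa using hij
      rw [cartanAAffine_eq_zero_of_parity h (by simp [evenOddEquiv, Nat.add_mod])]
      simp [hij]

theorem charpoly_bipartite_blocks {m : Type*} [Fintype m] [DecidableEq m] {R : Type*} [CommRing R]
    (S T : Matrix m m R) (hST : S * T = 1) :
    (Matrix.fromBlocks (-1) (1 + S) 0 1 * Matrix.fromBlocks 1 0 (1 + T) (-1)).charpoly =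
      S.charpoly * T.charpoly := by
  have hTS : T * S = 1 := mul_eq_one_comm.1 hST
  let U : (Matrix (m ⊕ m) (m ⊕ m) R)ˣ :=
    ⟨Matrix.fromBlocks 1 S 0 1, Matrix.fromBlocks 1 (-S) 0 1,
      by simp [Matrix.fromBlocks_multiply], by simp [Matrix.fromBlocks_multiply]⟩
  have hconj : Matrix.fromBlocks (-1) (1 + S) 0 1 * Matrix.fromBlocks 1 0 (1 + T) (-1) =
      U.val * Matrix.fromBlocks T 0 (1 + T) S * U⁻¹.val := by
    rw [Units.eq_mul_inv_iff_mul_eq]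
    simp only [U, Matrix.fromBlocks_multiply]
    congr 1 <;> simp [mul_add, add_mul, hST, hTS] <;> abel
  rw [hconj, Matrix.charpoly_mul_comm, ← mul_assoc, Units.inv_mul, one_mul,
    Matrix.charpoly_fromBlocks_zero₁₂, mul_comm]

theorem charpoly_affineCoxeter {n : ℕ} (hn : 1 ≤ n) :
    ((((List.finRange (2 * n)).filter fun i => i.val % 2 = 0).map
          (simpleRefl (cartanAAffine (2 * n)))).prod
        * (((List.finRange (2 * n)).filter fun i => i.val % 2 = 1).map
          (simpleRefl (cartanAAffine (2 * n)))).prod).charpoly = (X ^ n - 1) ^ 2 := by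
  rw [← Matrix.charpoly_reindex (evenOddEquiv n).symm, Matrix.reindex_apply, Equiv.symm_symm,
    ← Matrix.submatrix_mul_equiv _ _ _ (evenOddEquiv n), prod_even_simpleRefl_submatrix,
    prod_odd_simpleRefl_submatrix,
    charpoly_bipartite_blocks _ _ (cyclicShift_mul_transpose_self n), Matrix.charpoly_transpose,
    charpoly_cyclicShift hn, sq]

/-- Theorem 2 for type `A_{2n-1}`: with `l = 2n-1`, the Coxeter element `c = s₁s₂⋯s_l`
of the Cartan matrix of type `A_l` and the affine Coxeter element
`c_a = (s₀s₂⋯s_{2n-2})·(s₁s₃⋯s_{2n-1})` of the affine Cartan matrix of type `A_l^{(1)}`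
taken in the bipartite ordering satisfy `det(tI - c)·(t-1) = t^{2n} - 1`,
`det(tI - c_a) = (t^n - 1)²`, and the Poincaré series
`p(t) = (1-t^{2n})/((1-t)(1-t^n)²)` of the Kleinian singularity of type `A_{2n-1}`
equals `det(tI - c)/det(tI - c_a)` as a rational function. -/
theorem poincare_series_A_odd (n : ℕ) (hn : 1 ≤ n)
    (c : Matrix (Fin (2 * n - 1)) (Fin (2 * n - 1)) ℚ)
    (hc : c = (List.ofFn fun i : Fin (2 * n - 1) =>
      simpleRefl (cartanA (2 * n - 1)) i).prod)
    (ca : Matrix (Fin (2 * n)) (Fin (2 * n)) ℚ)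
    (hca : ca = (((List.finRange (2 * n)).filter fun i => i.val % 2 = 0).map
          (simpleRefl (cartanAAffine (2 * n)))).prod
        * (((List.finRange (2 * n)).filter fun i => i.val % 2 = 1).map
          (simpleRefl (cartanAAffine (2 * n)))).prod) :
    c.charpoly * (X - 1) = X ^ (2 * n) - 1 ∧
    ca.charpoly = (X ^ n - 1) ^ 2 ∧
    (1 - RatFunc.X ^ (2 * n)) /
        ((1 - RatFunc.X) * (1 - RatFunc.X ^ n) ^ 2)
      = algebraMap (Polynomial ℚ) (RatFunc ℚ) c.charpoly /
        algebraMap (Polynomial ℚ) (RatFunc ℚ) ca.charpoly := by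
  have h1 : c.charpoly * (X - 1) = X ^ (2 * n) - 1 := by
    rw [hc, charpoly_coxeter_cartanA, Nat.sub_add_cancel (by omega)]
  have h2 : ca.charpoly = (X ^ n - 1) ^ 2 := by rw [hca, charpoly_affineCoxeter hn]
  refine ⟨h1, h2, ?_⟩
  have h1' := congrArg (algebraMap ℚ[X] (RatFunc ℚ)) h1
  simp only [map_mul, map_sub, map_pow, map_one, RatFunc.algebraMap_X] at h1'
  have hX : ∀ k : ℕ, 1 ≤ k → (RatFunc.X : RatFunc ℚ) ^ k - 1 ≠ 0 := by
    intro k hk h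
    have hpoly : algebraMap ℚ[X] (RatFunc ℚ) (X ^ k - 1) = 0 := by
      simpa [RatFunc.algebraMap_X] using h
    exact (monic_X_pow_sub_C (1 : ℚ) (by omega : k ≠ 0)).ne_zero
      (by simpa using (map_eq_zero_iff _ (RatFunc.algebraMap_injective ℚ)).1 hpoly)
  have hX1 : (1 - RatFunc.X : RatFunc ℚ) ≠ 0 := by
    intro h
    exact hX 1 le_rfl (by linear_combination -h)
  have hXn : (1 - RatFunc.X ^ n : RatFunc ℚ) ≠ 0 := by
    intro h
    exact hX n hn (by linear_combination -h)
  rw [h2]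
  simp only [map_sub, map_pow, map_one, RatFunc.algebraMap_X]
  rw [div_eq_div_iff (mul_ne_zero hX1 (pow_ne_zero 2 hXn)) (pow_ne_zero 2 (hX n hn))]
  linear_combination (RatFunc.X ^ n - 1) ^ 2 * h1'
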